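/- arXiv:math/0404229 — 3 statements merged into one kernel-verified Lean document; each statement's English description precedes it below -/
import Mathlib

section
/- Let k be a field and M ∈ Flk(k). Then M is a bound k[F_μ]-module: every k[F_μ]-linear map M → k[F_μ] is zero, i.e., Hom_{k[F_μ]}(M, k[F_μ]) = 0. -/
open Finsupp

noncomputable section

/-- The free group `F_μ` on `μ` generators. -/
abbrev FG (μ : ℕ) : Type := FreeGroup (Fin μ)

/-- The group ring `A[F_μ]`. -/
abbrev GR (μ : ℕ) (A : Type*) [Ring A] : Type _ := MonoidAlgebra A (FG μ)

/-- The augmentation ring homomorphism `ε : A[F_μ] → A` sending every element of `F_μ` to `1`. -/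
def aug (μ : ℕ) (A : Type*) [Ring A] : GR μ A →+* A :=
  MonoidAlgebra.liftNCRingHom (RingHom.id A) 1 (fun x y => by simp)


/-- The augmentation `ε(σ) : A^n → A^n` of an `A[F_μ]`-linear endomorphism `σ` of
`(A[F_μ])^n`. -/
def augPi (μ : ℕ) (A : Type*) [Ring A] {n : ℕ}
    (σ : (Fin n → GR μ A) →ₗ[GR μ A] (Fin n → GR μ A)) : (Fin n → A) → (Fin n → A) :=
  fun v j => aug μ A (σ (fun i => MonoidAlgebra.single 1 (v i)) j)

/-- `M` is an `F_μ`-link module over the field `k` (`M ∈ Flk(k)`): there are `n ≥ 0` and an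
exact sequence `0 → (k[F_μ])^n →^σ (k[F_μ])^n → M → 0` with `ε(σ) : k^n → k^n` invertible. -/
def IsFlkField (μ : ℕ) (k : Type*) [Field k] (M : Type*) [AddCommGroup M]
    [Module (GR μ k) M] : Prop :=
  ∃ (n : ℕ) (σ : (Fin n → GR μ k) →ₗ[GR μ k] (Fin n → GR μ k))
    (p : (Fin n → GR μ k) →ₗ[GR μ k] M),
      Function.Injective σ ∧ Function.Surjective p ∧ LinearMap.range σ = LinearMap.ker p ∧
      Function.Bijective (augPi μ k σ)



namespace FreeGroupRing

variable {μ : ℕ} {k : Type*} [CommRing k]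

theorem aug_single (g : FG μ) (r : k) : aug μ k (MonoidAlgebra.single g r) = r := by
  change MonoidAlgebra.liftNC _ _ _ = r
  simp [MonoidAlgebra.liftNC_single]

theorem aug_smul (r : k) (x : GR μ k) : aug μ k (r • x) = r * aug μ k x := by
  rw [Algebra.smul_def, map_mul]
  congr 1
  exact aug_single 1 r

/-- The affine action of the free group on its group ring for which `z_j` acts by
`x ↦ z_j x + δ_ij`. -/
def foxPerm (μ : ℕ) (k : Type*) [CommRing k] (i : Fin μ) : FG μ →* Equiv.Perm (GR μ k) :=
  FreeGroup.lift fun j =>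
    (Units.mulLeft (Units.map (MonoidAlgebra.of k (FG μ)) (toUnits (FreeGroup.of j)))).trans
      (Equiv.addRight (if i = j then 1 else 0))

theorem foxPerm_of (i j : Fin μ) (x : GR μ k) :
    foxPerm μ k i (FreeGroup.of j) x =
      MonoidAlgebra.of k (FG μ) (FreeGroup.of j) * x + if i = j then 1 else 0 := by
  simp [foxPerm]

theorem foxPerm_apply (i : Fin μ) (g : FG μ) (x : GR μ k) :
    foxPerm μ k i g x = MonoidAlgebra.of k (FG μ) g * x + foxPerm μ k i g 0 := by
  induction g using FreeGroup.induction_on generalizing x with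
  | C1 => simp [← MonoidAlgebra.one_def]
  | of j => simp [foxPerm_of]
  | inv_of j ih =>
    have h := ih ((foxPerm μ k i (FreeGroup.of j))⁻¹ 0)
    rw [← Equiv.Perm.mul_apply, mul_inv_cancel, Equiv.Perm.one_apply] at h
    rw [map_inv, Equiv.Perm.inv_eq_iff_eq, ih, mul_add, ← mul_assoc, ← map_mul,
      mul_inv_cancel, map_one, one_mul, add_assoc, ← h, add_zero]
  | mul g h hg hh =>
    rw [map_mul, Equiv.Perm.mul_apply, Equiv.Perm.mul_apply, hh, hg, hg (foxPerm μ k i h 0),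
      map_mul, mul_add, mul_assoc, add_assoc]

/-- The Fox derivative `∂/∂z_i` on the group ring of the free group. -/
def fox (μ : ℕ) (k : Type*) [CommRing k] (i : Fin μ) : GR μ k →ₗ[k] GR μ k :=
  Finsupp.linearCombination k (fun g => foxPerm μ k i g 0) ∘ₗ
    (MonoidAlgebra.coeffLinearEquiv k).toLinearMap

theorem fox_of (i : Fin μ) (g : FG μ) :
    fox μ k i (MonoidAlgebra.of k (FG μ) g) = foxPerm μ k i g 0 := by
  simp [fox]

theorem aug_of (g : FG μ) : aug μ k (MonoidAlgebra.of k (FG μ) g) = 1 := aug_single g 1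

theorem fox_mul (i : Fin μ) (x y : GR μ k) :
    fox μ k i (x * y) = x * fox μ k i y + aug μ k y • fox μ k i x := by
  induction x using MonoidAlgebra.induction_on with
  | of g =>
    induction y using MonoidAlgebra.induction_on with
    | of h =>
      rw [← map_mul, fox_of, fox_of, fox_of, aug_of, one_smul, map_mul, Equiv.Perm.mul_apply,
        foxPerm_apply]
    | add y z hy hz => rw [mul_add, map_add, hy, hz, map_add, map_add, mul_add, add_smul]; abel
    | smul r y hy =>
      rw [mul_smul_comm, map_smul, hy, map_smul, aug_smul, mul_smul_comm, smul_add, mul_smul]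
  | add x z hx hz => rw [add_mul, map_add, hx, hz, map_add, add_mul, smul_add]; abel
  | smul r x hx =>
    rw [smul_mul_assoc, map_smul, hx, map_smul, smul_mul_assoc, smul_add, smul_comm r]

variable (k) in
/-- The generator `z_j` as an element of the group ring. -/
def gen (j : Fin μ) : GR μ k := MonoidAlgebra.of k (FG μ) (FreeGroup.of j)

variable (k) in
/-- The inverse `z_j⁻¹` of a generator as an element of the group ring. -/
def genInv (j : Fin μ) : GR μ k := MonoidAlgebra.of k (FG μ) (FreeGroup.of j)⁻¹

theorem gen_mul_genInv (j : Fin μ) : gen k j * genInv k j = 1 := by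
  rw [gen, genInv, ← map_mul, mul_inv_cancel, map_one]

theorem genInv_mul_gen (j : Fin μ) : genInv k j * gen k j = 1 := by
  rw [gen, genInv, ← map_mul, inv_mul_cancel, map_one]

theorem fox_one (i : Fin μ) : fox μ k i 1 = 0 := by
  have h := fox_mul (k := k) i 1 1
  simpa using h

theorem fox_mul_gen (i j : Fin μ) (x : GR μ k) :
    fox μ k i (x * gen k j) = (if i = j then x else 0) + fox μ k i x := by
  rw [fox_mul, gen, aug_of, one_smul, fox_of, foxPerm_of]
  simp

theorem fox_mul_genInv (i j : Fin μ) (x : GR μ k) :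
    fox μ k i (x * genInv k j) = fox μ k i x - if i = j then x * genInv k j else 0 := by
  have h := fox_mul_gen i j (x * genInv k j)
  rw [mul_assoc, genInv_mul_gen, mul_one] at h
  rw [h]; abel

/-- The fundamental formula of the Fox calculus. -/
theorem eq_aug_add_sum_fox (x : GR μ k) :
    x = algebraMap k _ (aug μ k x) + ∑ i, fox μ k i x * (gen k i - 1) := by
  induction x using MonoidAlgebra.induction_on with
  | of g =>
    rw [aug_of, map_one]
    induction g using FreeGroup.induction_on with
    | C1 => simp only [map_one, fox_one]; simp
    | of j =>
      have h (i : Fin μ) := fox_mul_gen (k := k) i j 1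
      simp only [one_mul, fox_one, add_zero] at h
      change gen k j = 1 + ∑ i, fox μ k i (gen k j) * _
      simp [h]
    | inv_of j =>
      have h (i : Fin μ) := fox_mul_genInv (k := k) i j 1
      simp only [one_mul, fox_one, zero_sub] at h
      change genInv k j = 1 + ∑ i, fox μ k i (genInv k j) * _
      simp only [h, mul_sub, neg_mul, ite_mul, zero_mul, genInv_mul_gen, mul_one,
        Finset.sum_sub_distrib, Finset.sum_neg_distrib, Finset.sum_ite_eq', Finset.mem_univ,
        if_true]
      abel
    | mul g h hg hh =>
      simp only [map_mul, fox_mul, aug_of, one_smul, add_mul, Finset.sum_add_distrib, mul_assoc]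
      rw [← Finset.mul_sum, ← sub_eq_iff_eq_add'.mpr hh, ← sub_eq_iff_eq_add'.mpr hg, mul_sub, mul_one]
      abel
  | add x y hx hy =>
    simp only [map_add, add_mul, Finset.sum_add_distrib]
    nth_rw 1 [hx, hy]
    abel
  | smul r x hx =>
    simp only [aug_smul, map_smul, map_mul, smul_mul_assoc, ← Finset.smul_sum]
    nth_rw 1 [hx]
    rw [smul_add, Algebra.smul_def, Algebra.smul_def]

/-- The coefficient of the Magnus expansion at a word in the generators: the augmentation of the
corresponding iterated Fox derivative. -/
def magnusCoeff : List (Fin μ) → GR μ k → k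
  | [], x => aug μ k x
  | i :: l, x => magnusCoeff l (fox μ k i x)

theorem magnusCoeff_add (l : List (Fin μ)) (x y : GR μ k) :
    magnusCoeff l (x + y) = magnusCoeff l x + magnusCoeff l y := by
  induction l generalizing x y with
  | nil => simp [magnusCoeff]
  | cons i l ih => simp [magnusCoeff, ih]

/-- All Magnus coefficients of `x` vanish. -/
def MagnusZero (x : GR μ k) : Prop := ∀ l, magnusCoeff l x = 0

theorem MagnusZero.fox {x : GR μ k} (hx : MagnusZero x) (i : Fin μ) :
    MagnusZero (fox μ k i x) := fun l => hx (i :: l)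

theorem MagnusZero.mul_gen {x : GR μ k} (hx : MagnusZero x) (j : Fin μ) :
    MagnusZero (x * gen k j) := by
  rintro (_ | ⟨i, l⟩)
  · rw [magnusCoeff, map_mul, gen, aug_of, mul_one]
    exact hx []
  · rw [magnusCoeff, fox_mul_gen, magnusCoeff_add, hx.fox i l, add_zero]
    split_ifs
    · exact hx l
    · simpa using magnusCoeff_add l (0 : GR μ k) 0

theorem MagnusZero.eq_zero_of_fox {x : GR μ k} (hx : MagnusZero x)
    (h : ∀ i, FreeGroupRing.fox μ k i x = 0) : x = 0 := by
  have h0 : aug μ k x = 0 := hx []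
  rw [eq_aug_add_sum_fox x]
  simp [h, h0]

/-- The submodules which behave like the span of the vertices of a finite subtree of the Cayley
tree containing `1`, and on which the Magnus expansion is injective. -/
structure IsFoxStable (W : Submodule k (GR μ k)) : Prop where
  one_mem : 1 ∈ W
  fox_mem : ∀ i, ∀ x ∈ W, fox μ k i x ∈ W
  fox_mul_gen_mem : ∀ i, ∀ x ∈ W, fox μ k i x * gen k i ∈ W
  eq_zero : ∀ x ∈ W, MagnusZero x → x = 0

theorem isFoxStable_span_one : IsFoxStable (Submodule.span k {(1 : GR μ k)}) := by
  have h (i : Fin μ) (x) (hx : x ∈ Submodule.span k {(1 : GR μ k)}) : fox μ k i x = 0 := by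
    obtain ⟨c, rfl⟩ := Submodule.mem_span_singleton.mp hx
    rw [map_smul, fox_one, smul_zero]
  refine ⟨Submodule.mem_span_singleton_self _, fun i x hx => ?_, fun i x hx => ?_,
    fun x hx hz => hz.eq_zero_of_fox fun i => h i x hx⟩
  · rw [h i x hx]; exact zero_mem _
  · rw [h i x hx, zero_mul]; exact zero_mem _

theorem IsFoxStable.sup_mul_gen {W : Submodule k (GR μ k)} (hW : IsFoxStable W) {u : GR μ k}
    (hu : u ∈ W) (j : Fin μ) : IsFoxStable (W ⊔ Submodule.span k {u * gen k j}) := by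
  have key (i : Fin μ) (x) (hx : x ∈ W ⊔ Submodule.span k {u * gen k j}) :
      fox μ k i x ∈ W ∧ fox μ k i x * gen k i ∈ W ⊔ Submodule.span k {u * gen k j} := by
    obtain ⟨w, hw, _, hv, rfl⟩ := Submodule.mem_sup.mp hx
    obtain ⟨c, rfl⟩ := Submodule.mem_span_singleton.mp hv
    rw [map_add, map_smul, fox_mul_gen]
    refine ⟨add_mem (hW.fox_mem i w hw) (W.smul_mem c (add_mem ?_ (hW.fox_mem i u hu))), ?_⟩
    · split_ifs
      exacts [hu, zero_mem _]
    · rw [add_mul, smul_mul_assoc, add_mul]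
      refine add_mem (Submodule.mem_sup_left (hW.fox_mul_gen_mem i w hw))
        (Submodule.smul_mem _ c (add_mem ?_
          (Submodule.mem_sup_left (hW.fox_mul_gen_mem i u hu))))
      split_ifs with hij
      · subst hij
        exact Submodule.mem_sup_right (Submodule.mem_span_singleton_self _)
      · rw [zero_mul]; exact zero_mem _
  exact ⟨Submodule.mem_sup_left hW.one_mem,
    fun i x hx => Submodule.mem_sup_left (key i x hx).1, fun i x hx => (key i x hx).2,
    fun x hx hz => hz.eq_zero_of_fox fun i => hW.eq_zero _ (key i x hx).1 (hz.fox i)⟩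

theorem IsFoxStable.sup_mul_genInv {W : Submodule k (GR μ k)} (hW : IsFoxStable W) {u : GR μ k}
    (hu : u ∈ W) (j : Fin μ) : IsFoxStable (W ⊔ Submodule.span k {u * genInv k j}) := by
  have key (i : Fin μ) (x) (hx : x ∈ W ⊔ Submodule.span k {u * genInv k j}) :
      fox μ k i x ∈ W ⊔ Submodule.span k {u * genInv k j} ∧ (i ≠ j → fox μ k i x ∈ W) ∧
        fox μ k i x * gen k i ∈ W := by
    obtain ⟨w, hw, _, hv, rfl⟩ := Submodule.mem_sup.mp hx
    obtain ⟨c, rfl⟩ := Submodule.mem_span_singleton.mp hv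
    rw [map_add, map_smul, fox_mul_genInv]
    refine ⟨add_mem (Submodule.mem_sup_left (hW.fox_mem i w hw))
      (Submodule.smul_mem _ c (sub_mem (Submodule.mem_sup_left (hW.fox_mem i u hu)) ?_)),
      fun hij => ?_, ?_⟩
    · split_ifs
      exacts [Submodule.mem_sup_right (Submodule.mem_span_singleton_self _), zero_mem _]
    · rw [if_neg hij, sub_zero]
      exact add_mem (hW.fox_mem i w hw) (W.smul_mem c (hW.fox_mem i u hu))
    · rw [add_mul, smul_mul_assoc, sub_mul]
      refine add_mem (hW.fox_mul_gen_mem i w hw)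
        (W.smul_mem c (sub_mem (hW.fox_mul_gen_mem i u hu) ?_))
      split_ifs with hij
      · subst hij
        rwa [mul_assoc, genInv_mul_gen, mul_one]
      · rw [zero_mul]; exact zero_mem _
  refine ⟨Submodule.mem_sup_left hW.one_mem, fun i x hx => (key i x hx).1,
    fun i x hx => Submodule.mem_sup_left (key i x hx).2.2,
    fun x hx hz => hz.eq_zero_of_fox fun i => ?_⟩
  have h := hW.eq_zero _ (key i x hx).2.2 ((hz.fox i).mul_gen i)
  rw [← mul_one (fox μ k i x), ← gen_mul_genInv i, ← mul_assoc, h, zero_mul]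

theorem IsFoxStable.exists_mul_of_mem {W : Submodule k (GR μ k)} (hW : IsFoxStable W)
    {u : GR μ k} (hu : u ∈ W) (g : FG μ) :
    ∃ W', IsFoxStable W' ∧ W ≤ W' ∧ u * MonoidAlgebra.of k (FG μ) g ∈ W' := by
  induction g using FreeGroup.induction_on generalizing W u with
  | C1 => exact ⟨W, hW, le_rfl, by rwa [map_one, mul_one]⟩
  | of j => exact ⟨_, hW.sup_mul_gen hu j, le_sup_left,
      Submodule.mem_sup_right (Submodule.mem_span_singleton_self _)⟩
  | inv_of j => exact ⟨_, hW.sup_mul_genInv hu j, le_sup_left,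
      Submodule.mem_sup_right (Submodule.mem_span_singleton_self _)⟩
  | mul g h hg hh =>
    obtain ⟨W₁, hW₁, hle₁, hu₁⟩ := hg hW hu
    obtain ⟨W₂, hW₂, hle₂, hu₂⟩ := hh hW₁ hu₁
    exact ⟨W₂, hW₂, hle₁.trans hle₂, by rwa [map_mul, ← mul_assoc]⟩

theorem IsFoxStable.exists_mem {W : Submodule k (GR μ k)} (hW : IsFoxStable W) (x : GR μ k) :
    ∃ W', IsFoxStable W' ∧ W ≤ W' ∧ x ∈ W' := by
  induction x using MonoidAlgebra.induction_on generalizing W with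
  | of g => simpa only [one_mul] using hW.exists_mul_of_mem hW.one_mem g
  | add x y hx hy =>
    obtain ⟨W₁, hW₁, hle₁, hx₁⟩ := hx hW
    obtain ⟨W₂, hW₂, hle₂, hy₂⟩ := hy hW₁
    exact ⟨W₂, hW₂, hle₁.trans hle₂, add_mem (hle₂ hx₁) hy₂⟩
  | smul r x hx =>
    obtain ⟨W₁, hW₁, hle₁, hx₁⟩ := hx hW
    exact ⟨W₁, hW₁, hle₁, W₁.smul_mem r hx₁⟩

/-- The Magnus expansion of the group ring of a free group is injective. -/
theorem MagnusZero.eq_zero {x : GR μ k} (hx : MagnusZero x) : x = 0 := by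
  obtain ⟨W, hW, -, hxW⟩ := isFoxStable_span_one.exists_mem x
  exact hW.eq_zero x hxW hx

/-- A vector annihilated by a matrix with surjective augmentation vanishes. -/
theorem eq_zero_of_sum_mul_eq_zero {n : ℕ}
    {σ : (Fin n → GR μ k) →ₗ[GR μ k] (Fin n → GR μ k)} (hσ : Function.Surjective (augPi μ k σ))
    {a : Fin n → GR μ k} (ha : ∀ x, ∑ j, σ x j * a j = 0) : a = 0 := by
  have aug_eq_zero {a : Fin n → GR μ k} (ha : ∀ x, ∑ j, σ x j * a j = 0) (p : Fin n) :
      aug μ k (a p) = 0 := by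
    obtain ⟨v, hv⟩ := hσ (Pi.single p 1)
    have h := congrArg (aug μ k) (ha fun i => MonoidAlgebra.single 1 (v i))
    have hv' (j : Fin n) : aug μ k (σ (fun i => MonoidAlgebra.single 1 (v i)) j) =
        (Pi.single p 1 : Fin n → k) j := congrFun hv j
    simpa [map_sum, map_mul, hv', Pi.single_apply] using h
  funext p
  refine MagnusZero.eq_zero fun l => ?_
  induction l generalizing a with
  | nil => exact aug_eq_zero ha p
  | cons i l ih =>
    refine ih (a := fun j => fox μ k i (a j)) fun x => ?_
    simpa [map_sum, fox_mul, aug_eq_zero ha] using congrArg (fox μ k i) (ha x)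

end FreeGroupRing

/-- Every `M ∈ Flk(k)` is a bound `k[F_μ]`-module:
`Hom_{k[F_μ]}(M, k[F_μ]) = 0`. -/
theorem statement8 (μ : ℕ) (k : Type*) [Field k]
    (M : Type*) [AddCommGroup M] [Module (GR μ k) M] (hM : IsFlkField μ k M) :
    ∀ f : M →ₗ[GR μ k] (GR μ k), f = 0 := by
  intro f
  obtain ⟨n, σ, p, -, hp, hexact, hσ⟩ := hM
  have expand (y : Fin n → GR μ k) : f (p y) = ∑ j, y j * f (p (Pi.single j 1)) := by
    conv_lhs => rw [pi_eq_sum_univ' y]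
    simp [map_sum]
  have ha : (fun j => f (p (Pi.single j 1))) = 0 := by
    refine FreeGroupRing.eq_zero_of_sum_mul_eq_zero hσ.surjective fun x => ?_
    have hx : σ x ∈ LinearMap.ker p := hexact ▸ LinearMap.mem_range_self σ x
    rw [← expand, LinearMap.mem_ker.mp hx, map_zero]
  ext m
  obtain ⟨y, rfl⟩ := hp m
  rw [expand]
  simp [fun j => congrFun ha j]
end
end

section
/- Let k be a field and M ∈ Flk(k). Then the endomorphism ring End_{k[F_μ]}(M) of M as a k[F_μ]-module is a finite-dimensional vector space over k. -/
open Finsupp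

noncomputable section

namespace FLink

variable {μ : ℕ} {k : Type*} [Field k]

/-- The generator `z_i` as an element of the group ring. -/
def gen (k : Type*) [Field k] (i : Fin μ) : GR μ k := MonoidAlgebra.of k (FG μ) (FreeGroup.of i)

/-- The inverse `z_i⁻¹` of a generator as an element of the group ring. -/
def genInv (k : Type*) [Field k] (i : Fin μ) : GR μ k :=
  MonoidAlgebra.of k (FG μ) (FreeGroup.of i)⁻¹

theorem gen_mul_genInv (i : Fin μ) : gen k i * genInv k i = 1 := by
  rw [gen, genInv, ← map_mul, mul_inv_cancel, map_one]

theorem genInv_mul_gen (i : Fin μ) : genInv k i * gen k i = 1 := by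
  rw [gen, genInv, ← map_mul, inv_mul_cancel, map_one]

/-- A set stable under addition and under the action of `k`, the `z_i` and the `z_i⁻¹` is stable
under the action of the group ring. -/
theorem smul_mem_of_gen {N : Type*} [AddCommGroup N] [Module (GR μ k) N] [Module k N]
    [IsScalarTower k (GR μ k) N] (S : Submodule k N)
    (hz : ∀ i : Fin μ, ∀ m ∈ S, gen k i • m ∈ S) (hz' : ∀ i : Fin μ, ∀ m ∈ S, genInv k i • m ∈ S)
    (r : GR μ k) {m : N} (hm : m ∈ S) : r • m ∈ S := by
  have hg : ∀ g : FG μ, ∀ m ∈ S, MonoidAlgebra.of k (FG μ) g • m ∈ S := by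
    intro g
    induction g using FreeGroup.induction_on with
    | C1 => intro m hm; simpa only [map_one, one_smul] using hm
    | of i => exact hz i
    | inv_of i _ => exact hz' i
    | mul x y hx hy =>
      intro m hm
      rw [map_mul, mul_smul]
      exact hx _ (hy _ hm)
  induction r using MonoidAlgebra.induction_on with
  | of g => exact hg g m hm
  | add a b ha hb => rw [add_smul]; exact S.add_mem ha hb
  | smul c a ha => rw [smul_assoc]; exact S.smul_mem c ha

section Derivation

variable {N : Type*} [AddCommGroup N] [Module (GR μ k) N] [Module k N]

/-- A family `D` of left inverses of the multiplications by `z_i - 1`, orthogonal to each other. -/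
def IsFox (D : Fin μ → N →ₗ[k] N) : Prop :=
  ∀ (i j : Fin μ) (n : N), D i ((gen k j - 1) • n) = if i = j then n else 0

theorem IsFox.map_gen_smul {D : Fin μ → N →ₗ[k] N} (hD : IsFox D) (i j : Fin μ) (n : N) :
    D i (gen k j • n) = D i n + if i = j then n else 0 := by
  rw [← hD i j n, ← map_add, sub_smul, one_smul, add_sub_cancel]

theorem IsFox.map_genInv_smul {D : Fin μ → N →ₗ[k] N} (hD : IsFox D) (i j : Fin μ) (n : N) :
    D i (genInv k j • n) = D i n - if i = j then genInv k j • n else 0 := by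
  have h := hD.map_gen_smul i j (genInv k j • n)
  rw [← mul_smul, gen_mul_genInv, one_smul] at h
  rw [h, add_sub_cancel_right]

theorem map_comm {D : Fin μ → N →ₗ[k] N} (hD : IsFox D)
    (hsum : ∀ m, ∑ i, (gen k i - 1) • D i m = m) (f : N →ₗ[GR μ k] N) (i : Fin μ) (m : N) :
    f (D i m) = D i (f m) := by
  conv_rhs => rw [← hsum m]
  simp only [map_sum, map_smul]
  simp [hD i]

/-- Stability of a subspace under the operators `D_i` and `(z_i - 1) D_i`. -/
def Inv (D : Fin μ → N →ₗ[k] N) (P : Submodule k N) : Prop :=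
  ∀ i, ∀ m ∈ P, D i m ∈ P ∧ (gen k i - 1) • D i m ∈ P

variable [IsScalarTower k (GR μ k) N]

/-- The subspace `P + rP`. -/
def step (r : GR μ k) (P : Submodule k N) : Submodule k N :=
  P ⊔ P.map (Algebra.lsmul k k N r)

theorem mem_step {r : GR μ k} {P : Submodule k N} {m : N} :
    m ∈ step r P ↔ ∃ p ∈ P, ∃ q ∈ P, p + r • q = m := by
  simp [step, Submodule.mem_sup]

theorem le_step (r : GR μ k) (P : Submodule k N) : P ≤ step r P := le_sup_left

theorem smul_mem_step (r : GR μ k) {P : Submodule k N} {m : N} (hm : m ∈ P) :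
    r • m ∈ step r P := mem_step.2 ⟨0, P.zero_mem, m, hm, zero_add _⟩

theorem Inv.step_gen {D : Fin μ → N →ₗ[k] N} (hD : IsFox D) {P : Submodule k N} (hP : Inv D P)
    (j : Fin μ) : Inv D (step (gen k j - 1) P) := by
  intro i m hm
  obtain ⟨p, hp, q, hq, rfl⟩ := mem_step.1 hm
  rw [map_add, hD]
  obtain ⟨h1, h2⟩ := hP i p hp
  split_ifs with h
  · subst h
    rw [smul_add]
    exact ⟨le_step _ _ (P.add_mem h1 hq), mem_step.2 ⟨_, h2, q, hq, rfl⟩⟩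
  · rw [add_zero]
    exact ⟨le_step _ _ h1, le_step _ _ h2⟩

theorem Inv.step_genInv {D : Fin μ → N →ₗ[k] N} (hD : IsFox D) {P : Submodule k N}
    (hP : Inv D P) (j : Fin μ) : Inv D (step (genInv k j) P) := by
  intro i m hm
  obtain ⟨p, hp, q, hq, rfl⟩ := mem_step.1 hm
  rw [map_add, hD.map_genInv_smul]
  obtain ⟨h1, h2⟩ := hP i p hp
  obtain ⟨h3, h4⟩ := hP i q hq
  split_ifs with h
  · subst h
    refine ⟨mem_step.2 ⟨D i p + D i q, P.add_mem h1 h3, -q, P.neg_mem hq, ?_⟩,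
      mem_step.2 ⟨(gen k i - 1) • D i p + ((gen k i - 1) • D i q - q),
        P.add_mem h2 (P.sub_mem h4 hq), q, hq, ?_⟩⟩
    · rw [smul_neg]; abel
    · have : (gen k i - 1) • genInv k i • q = q - genInv k i • q := by
        rw [sub_smul, ← mul_smul, gen_mul_genInv, one_smul, one_smul]
      rw [smul_add, smul_sub _ (D i q), this]; abel
  · rw [sub_zero, smul_add]
    exact ⟨le_step _ _ (P.add_mem h1 h3), le_step _ _ (P.add_mem h2 h4)⟩

/-- If a class of subspaces is stable under the steps by `z_j - 1` and `z_j⁻¹`, then its members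
above a given `P₀` absorb every element of the submodule generated by `P₀`. -/
theorem exists_le_mem_of_step (C : Submodule k N → Prop)
    (hX : ∀ P (j : Fin μ), C P → C (step (gen k j - 1) P))
    (hZ : ∀ P (j : Fin μ), C P → C (step (genInv k j) P))
    {P₀ P : Submodule k N} (hP₀ : P₀ ≤ P) (hP : C P) {m : N}
    (hm : m ∈ Submodule.span (GR μ k) (P₀ : Set N)) : ∃ Q, P ≤ Q ∧ C Q ∧ m ∈ Q := by
  let G : Submodule k N :=
    { carrier := {m | ∀ P, P₀ ≤ P → C P → ∃ Q, P ≤ Q ∧ C Q ∧ m ∈ Q}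
      zero_mem' := fun P _ hP => ⟨P, le_rfl, hP, P.zero_mem⟩
      add_mem' := by
        intro a b ha hb P h0 hP
        obtain ⟨Q, hPQ, hQ, haQ⟩ := ha P h0 hP
        obtain ⟨Q', hQQ', hQ', hbQ⟩ := hb Q (h0.trans hPQ) hQ
        exact ⟨Q', hPQ.trans hQQ', hQ', Q'.add_mem (hQQ' haQ) hbQ⟩
      smul_mem' := by
        intro c a ha P h0 hP
        obtain ⟨Q, hPQ, hQ, haQ⟩ := ha P h0 hP
        exact ⟨Q, hPQ, hQ, Q.smul_mem c haQ⟩ }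
  suffices h : m ∈ G from h P hP₀ hP
  induction hm using Submodule.span_induction with
  | mem x hx => exact fun P h0 hP => ⟨P, le_rfl, hP, h0 hx⟩
  | zero => exact G.zero_mem
  | add x y _ _ hx hy => exact G.add_mem hx hy
  | smul r x _ hx =>
    refine smul_mem_of_gen G ?_ ?_ r hx
    · intro i m hm P h0 hP
      obtain ⟨Q, hPQ, hQ, haQ⟩ := hm P h0 hP
      refine ⟨_, hPQ.trans (le_step _ _), hX Q i hQ, mem_step.2 ⟨m, haQ, m, haQ, ?_⟩⟩
      rw [sub_smul, one_smul, add_sub_cancel]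
    · intro i m hm P h0 hP
      obtain ⟨Q, hPQ, hQ, haQ⟩ := hm P h0 hP
      exact ⟨_, hPQ.trans (le_step _ _), hZ Q i hQ, smul_mem_step _ haQ⟩

/-- A finite-dimensional stable subspace generating the whole module. -/
structure IsLattice (D : Fin μ → N →ₗ[k] N) (L : Submodule k N) : Prop where
  finite : Module.Finite k L
  inv : Inv D L
  span_eq_top : Submodule.span (GR μ k) (L : Set N) = ⊤

/-- A lattice `L` is contained in the module generated by `L ∩ f⁻¹(L)`. -/
theorem le_span_inf_comap {D : Fin μ → N →ₗ[k] N} (hD : IsFox D)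
    (hsum : ∀ m, ∑ i, (gen k i - 1) • D i m = m) {L : Submodule k N} (hL : IsLattice D L)
    (f : N →ₗ[GR μ k] N) :
    (L : Set N) ⊆ (Submodule.span (GR μ k)
      ((L ⊓ L.comap (f.restrictScalars k) : Submodule k N) : Set N) : Set N) := by
  set T := Submodule.span (GR μ k)
    ((L ⊓ L.comap (f.restrictScalars k) : Submodule k N) : Set N)
  intro l hl
  have hfl : f l ∈ Submodule.span (GR μ k) (L : Set N) := by rw [hL.span_eq_top]; trivial
  suffices h : ∃ Q, L ≤ Q ∧ (Inv D Q ∧ ∀ l ∈ L, f l ∈ Q → l ∈ T) ∧ f l ∈ Q by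
    obtain ⟨Q, -, hQ, hmem⟩ := h
    exact hQ.2 l hl hmem
  refine exists_le_mem_of_step (fun P => Inv D P ∧ ∀ l ∈ L, f l ∈ P → l ∈ T) ?_ ?_ le_rfl
    ⟨hL.inv, fun l hl hfl => Submodule.subset_span ⟨hl, hfl⟩⟩ hfl
  · rintro P j ⟨hP, hPT⟩
    refine ⟨hP.step_gen hD j, fun l hl hfl => ?_⟩
    obtain ⟨p, hp, q, hq, hpq⟩ := mem_step.1 hfl
    rw [← hsum l]
    refine T.sum_mem fun i _ => T.smul_mem _ (hPT _ (hL.inv i l hl).1 ?_)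
    rw [map_comm hD hsum, ← hpq, map_add, hD]
    refine P.add_mem (hP i p hp).1 ?_
    split_ifs
    exacts [hq, P.zero_mem]
  · rintro P j ⟨hP, hPT⟩
    refine ⟨hP.step_genInv hD j, fun l hl hfl => ?_⟩
    obtain ⟨p, hp, q, hq, hpq⟩ := mem_step.1 hfl
    have key : ∀ i, D i l + (if i = j then l else 0) ∈ T := by
      intro i
      refine hPT _ (L.add_mem (hL.inv i l hl).1 ?_) ?_
      · split_ifs
        exacts [hl, L.zero_mem]
      · have : f (if i = j then l else 0) = if i = j then f l else 0 := by split_ifs <;> simp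
        rw [map_add, map_comm hD hsum, this, ← hpq, map_add, hD.map_genInv_smul]
        have h1 := P.add_mem (hP i p hp).1 (hP i q hq).1
        split_ifs
        · convert P.add_mem h1 hp using 1
          abel
        · simpa using h1
    have hgen : gen k j • l ∈ T := by
      have : gen k j • l = ∑ i, (gen k i - 1) • (D i l + if i = j then l else 0) := by
        simp only [smul_add, Finset.sum_add_distrib, hsum]
        simp [sub_smul]
      rw [this]
      exact T.sum_mem fun i _ => T.smul_mem _ (key i)
    have := T.smul_mem (genInv k j) hgen
    rwa [← mul_smul, genInv_mul_gen, one_smul] at this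

theorem exists_lattice_stable {D : Fin μ → N →ₗ[k] N} (hD : IsFox D)
    (hsum : ∀ m, ∑ i, (gen k i - 1) • D i m = m) (h : ∃ L, IsLattice D L) :
    ∃ L, IsLattice D L ∧ ∀ f : N →ₗ[GR μ k] N, ∀ l ∈ L, f l ∈ L := by
  classical
  have hex : ∃ d, ∃ L, IsLattice D L ∧ Module.finrank k L = d := by
    obtain ⟨L, hL⟩ := h
    exact ⟨_, L, hL, rfl⟩
  obtain ⟨L, hL, hd⟩ := Nat.find_spec hex
  refine ⟨L, hL, fun f => ?_⟩
  have := hL.finite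
  have hlat : IsLattice D (L ⊓ L.comap (f.restrictScalars k)) := by
    refine ⟨inferInstance, fun i m hm => ?_, ?_⟩
    · obtain ⟨h1, h2⟩ := hm
      have h2 : f m ∈ L := h2
      refine ⟨⟨(hL.inv i m h1).1, ?_⟩, (hL.inv i m h1).2, ?_⟩
      · change f (D i m) ∈ L
        rw [map_comm hD hsum]
        exact (hL.inv i _ h2).1
      · change f ((gen k i - 1) • D i m) ∈ L
        rw [map_smul, map_comm hD hsum]
        exact (hL.inv i _ h2).2
    · rw [eq_top_iff, ← hL.span_eq_top, Submodule.span_le]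
      exact le_span_inf_comap hD hsum hL f
  have hle := Nat.find_min' hex ⟨_, hlat, rfl⟩
  rw [← hd] at hle
  have heq := Submodule.eq_of_le_of_finrank_le inf_le_left hle
  intro l hl
  rw [← heq] at hl
  exact hl.2

end Derivation

section Fox

/-- The `k`-linear automorphism `(r, s) ↦ (z_j r, s + r e_j)` underlying the Fox calculus. -/
def foxEquiv (k : Type*) [Field k] (j : Fin μ) :
    (GR μ k × (Fin μ → GR μ k)) ≃ₗ[k] (GR μ k × (Fin μ → GR μ k)) where
  toFun x := (gen k j * x.1, x.2 + Pi.single j x.1)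
  invFun x := (genInv k j * x.1, x.2 - Pi.single j (genInv k j * x.1))
  map_add' x y := by
    ext1
    · simp [mul_add]
    · simp only [Prod.fst_add, Prod.snd_add, Pi.single_add]; abel
  map_smul' c x := by
    ext1
    · simp
    · simp [Pi.single_smul]
  left_inv x := by
    ext1
    · simp [← mul_assoc, genInv_mul_gen]
    · simp [← mul_assoc, genInv_mul_gen]
  right_inv x := by
    ext1
    · simp [← mul_assoc, gen_mul_genInv]
    · simp

/-- The action of the group ring underlying the Fox calculus. -/
def foxRep (μ : ℕ) (k : Type*) [Field k] :
    GR μ k →ₐ[k] Module.End k (GR μ k × (Fin μ → GR μ k)) :=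
  MonoidAlgebra.lift k _ (FG μ)
    ((Units.coeHom _).comp ((LinearMap.GeneralLinearGroup.generalLinearEquiv k _).symm.toMonoidHom.comp
      (FreeGroup.lift (foxEquiv k))))

theorem foxRep_gen (j : Fin μ) (x : GR μ k × (Fin μ → GR μ k)) :
    foxRep μ k (gen k j) x = (gen k j * x.1, x.2 + Pi.single j x.1) := by
  rw [foxRep, gen, MonoidAlgebra.lift_of]
  simp
  rfl

theorem foxRep_fst (r : GR μ k) : (foxRep μ k r (1, 0)).1 = r := by
  let S : Submodule k (GR μ k) := LinearMap.eqLocus ((LinearMap.fst k _ _).comp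
    ((LinearMap.applyₗ ((1, 0) : GR μ k × (Fin μ → GR μ k))).comp (foxRep μ k).toLinearMap))
    LinearMap.id
  have hS : ∀ r, r ∈ S ↔ (foxRep μ k r (1, 0)).1 = r := fun r => Iff.rfl
  have h := smul_mem_of_gen S (m := 1) ?_ ?_ r ((hS 1).2 (by simp))
  · rwa [smul_eq_mul, mul_one, hS] at h
  · intro i m hm
    rw [hS] at hm ⊢
    rw [smul_eq_mul, map_mul, Module.End.mul_apply, foxRep_gen, hm]
  · intro i m hm
    rw [hS] at hm ⊢
    have h1 : foxRep μ k (gen k i) (foxRep μ k (genInv k i * m) (1, 0)) = foxRep μ k m (1, 0) := by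
      rw [← Module.End.mul_apply, ← map_mul, ← mul_assoc, gen_mul_genInv, one_mul]
    rw [foxRep_gen] at h1
    have h2 := congrArg (fun x => genInv k i * x.1) h1
    simp only [hm, ← mul_assoc, genInv_mul_gen, one_mul] at h2
    exact h2

/-- The Fox derivatives. -/
def fox (μ : ℕ) (k : Type*) [Field k] (i : Fin μ) : GR μ k →ₗ[k] GR μ k :=
  (LinearMap.proj i).comp ((LinearMap.snd k _ _).comp
    ((LinearMap.applyₗ (1, 0)).comp (foxRep μ k).toLinearMap))

theorem isFox_fox : IsFox (fox μ k) := by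
  intro i j r
  have h : foxRep μ k ((gen k j - 1) * r) (1, 0) = foxRep μ k (gen k j) (foxRep μ k r (1, 0)) -
      foxRep μ k r (1, 0) := by
    rw [sub_mul, one_mul, map_sub, map_mul]; rfl
  change (foxRep μ k ((gen k j - 1) * r) (1, 0)).2 i = _
  rw [h, foxRep_gen, foxRep_fst]
  simp [Pi.single_apply]

theorem fox_one (i : Fin μ) : fox μ k i 1 = 0 := by
  simp [fox]

theorem aug_single (g : FG μ) (c : k) : aug μ k (MonoidAlgebra.single g c) = c := by
  simp [aug, MonoidAlgebra.liftNCRingHom]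

theorem aug_gen (i : Fin μ) : aug μ k (gen k i) = 1 := aug_single _ _

theorem aug_genInv (i : Fin μ) : aug μ k (genInv k i) = 1 := aug_single _ _

theorem algebraMap_eq_single (c : k) :
    algebraMap k (GR μ k) c = MonoidAlgebra.single 1 c := rfl

theorem aug_smul (c : k) (r : GR μ k) : aug μ k (c • r) = c * aug μ k r := by
  rw [Algebra.smul_def, map_mul, algebraMap_eq_single, aug_single]

/-- The augmentation as a linear map. -/
def augLin (μ : ℕ) (k : Type*) [Field k] : GR μ k →ₗ[k] k where
  toFun := aug μ k
  map_add' := map_add _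
  map_smul' := aug_smul

/-- The fundamental formula of the Fox calculus. -/
theorem aug_add_sum_fox (r : GR μ k) :
    algebraMap k (GR μ k) (aug μ k r) + ∑ i, (gen k i - 1) * fox μ k i r = r := by
  let S : Submodule k (GR μ k) := LinearMap.eqLocus ((Algebra.linearMap k _).comp (augLin μ k) +
    ∑ i, (LinearMap.mulLeft k (gen k i - 1)).comp (fox μ k i)) LinearMap.id
  have hS : ∀ r, r ∈ S ↔
      algebraMap k (GR μ k) (aug μ k r) + ∑ i, (gen k i - 1) * fox μ k i r = r := by
    intro r
    simp [S, LinearMap.mem_eqLocus, augLin]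
  have h := smul_mem_of_gen S (m := 1) ?_ ?_ r ((hS 1).2 (by simp only [fox_one, map_one, mul_zero,
    Finset.sum_const_zero, add_zero]))
  · rwa [smul_eq_mul, mul_one, hS] at h
  · intro i m hm
    rw [hS] at hm ⊢
    simp only [isFox_fox.map_gen_smul, mul_add, Finset.sum_add_distrib]
    rw [smul_eq_mul, map_mul, aug_gen, one_mul, ← add_assoc, hm]
    simp [sub_mul]
  · intro i m hm
    rw [hS] at hm ⊢
    simp only [isFox_fox.map_genInv_smul, mul_sub, Finset.sum_sub_distrib]
    rw [smul_eq_mul, map_mul, aug_genInv, one_mul, ← add_sub_assoc, hm]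
    simp [sub_mul, ← mul_assoc, gen_mul_genInv]

end Fox

section FreeModule

variable {n : ℕ}

/-- The Fox derivatives on a free module, computed coordinatewise. -/
def foxPi (μ : ℕ) (k : Type*) [Field k] (n : ℕ) (i : Fin μ) :
    (Fin n → GR μ k) →ₗ[k] (Fin n → GR μ k) :=
  (fox μ k i).compLeft (Fin n)

/-- The inclusion of `k^n` into the free module of rank `n`. -/
def const (μ : ℕ) (k : Type*) [Field k] (n : ℕ) : (Fin n → k) →ₗ[k] (Fin n → GR μ k) :=
  (Algebra.linearMap k (GR μ k)).compLeft (Fin n)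

theorem isFox_foxPi : IsFox (foxPi μ k n) := by
  intro i j v
  funext a
  have := isFox_fox i j (v a)
  rw [ite_apply]
  exact this

theorem foxPi_const (i : Fin μ) (c : Fin n → k) : foxPi μ k n i (const μ k n c) = 0 := by
  funext a
  change fox μ k i (algebraMap k _ (c a)) = 0
  rw [Algebra.algebraMap_eq_smul_one, map_smul, fox_one, smul_zero]

theorem const_add_sum_foxPi (v : Fin n → GR μ k) :
    const μ k n (aug μ k ∘ v) + ∑ i, (gen k i - 1) • foxPi μ k n i v = v := by
  funext a
  rw [Pi.add_apply, Finset.sum_apply]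
  exact aug_add_sum_fox (v a)

theorem aug_sum_gen_smul (w : Fin μ → Fin n → GR μ k) :
    aug μ k ∘ (∑ i, (gen k i - 1) • w i) = 0 := by
  funext a
  simp [Finset.sum_apply, map_sum, aug_gen]

theorem sum_foxPi_of_aug_eq_zero {v : Fin n → GR μ k} (hv : aug μ k ∘ v = 0) :
    ∑ i, (gen k i - 1) • foxPi μ k n i v = v := by
  have h := const_add_sum_foxPi v
  rwa [hv, map_zero, zero_add] at h

theorem aug_map (σ : (Fin n → GR μ k) →ₗ[GR μ k] (Fin n → GR μ k)) (v : Fin n → GR μ k) :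
    aug μ k ∘ σ v = augPi μ k σ (aug μ k ∘ v) := by
  have h : aug μ k ∘ σ v = aug μ k ∘ σ (const μ k n (aug μ k ∘ v)) := by
    conv_lhs => rw [← const_add_sum_foxPi v]
    have := aug_sum_gen_smul (fun i => σ (foxPi μ k n i v))
    funext a
    have h := congrFun this a
    simp only [Function.comp_apply, Pi.zero_apply] at h
    simp only [Function.comp_apply, map_add, map_sum, map_smul, Pi.add_apply, h, add_zero]
  exact h

theorem span_const : Submodule.span (GR μ k)
    (LinearMap.range (const μ k n) : Set (Fin n → GR μ k)) = ⊤ := by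
  rw [eq_top_iff]
  intro v _
  rw [pi_eq_sum_univ v]
  refine Submodule.sum_mem _ fun a _ => Submodule.smul_mem _ _ (Submodule.subset_span ?_)
  refine ⟨fun j => if a = j then 1 else 0, funext fun j => ?_⟩
  change algebraMap k (GR μ k) (if a = j then 1 else 0) = _
  split_ifs
  exacts [map_one _, map_zero _]

/-- Any finite family in a free module lies in a finite-dimensional subspace stable under the Fox
derivatives. -/
theorem exists_finite_inv {ι : Type*} (s : Finset ι) (v : ι → Fin n → GR μ k) :
    ∃ Q : Submodule k (Fin n → GR μ k), LinearMap.range (const μ k n) ≤ Q ∧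
      (Module.Finite k Q ∧ Inv (foxPi μ k n) Q) ∧ ∀ a ∈ s, v a ∈ Q := by
  classical
  induction s using Finset.induction_on with
  | empty =>
    refine ⟨_, le_rfl, ⟨inferInstance, ?_⟩, by simp⟩
    rintro i _ ⟨c, rfl⟩
    rw [foxPi_const, smul_zero]
    exact ⟨Submodule.zero_mem _, Submodule.zero_mem _⟩
  | insert a s _ ih =>
    obtain ⟨P, h0, hP, hs⟩ := ih
    obtain ⟨Q, hPQ, hQ, haQ⟩ := exists_le_mem_of_step
      (fun P => Module.Finite k P ∧ Inv (foxPi μ k n) P)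
      (fun P j ⟨_, hP⟩ => ⟨by unfold step; infer_instance, hP.step_gen isFox_foxPi j⟩)
      (fun P j ⟨_, hP⟩ => ⟨by unfold step; infer_instance, hP.step_genInv isFox_foxPi j⟩)
      h0 hP (m := v a) (by rw [span_const]; trivial)
    refine ⟨Q, h0.trans hPQ, hQ, fun b hb => ?_⟩
    rcases Finset.mem_insert.1 hb with rfl | hb
    exacts [haQ, hPQ (hs b hb)]

end FreeModule

section Presentation

variable {M : Type*} [AddCommGroup M] [Module (GR μ k) M] [Module k M]
  [IsScalarTower k (GR μ k) M]

/-- The map `(m_i) ↦ ∑ (z_i - 1) m_i`. -/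
def sumGen (μ : ℕ) (k : Type*) [Field k] (M : Type*) [AddCommGroup M] [Module (GR μ k) M]
    [Module k M] [IsScalarTower k (GR μ k) M] : (Fin μ → M) →ₗ[k] M :=
  ∑ i, (Algebra.lsmul k k M (gen k i - 1 : GR μ k)).comp (LinearMap.proj i)

theorem sumGen_apply (m : Fin μ → M) : sumGen μ k M m = ∑ i, (gen k i - 1 : GR μ k) • m i := by
  simp only [sumGen, LinearMap.sum_apply]
  rfl

variable {n : ℕ} {σ : (Fin n → GR μ k) →ₗ[GR μ k] (Fin n → GR μ k)}
  {p : (Fin n → GR μ k) →ₗ[GR μ k] M}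

theorem exists_const_sumGen (hσp : LinearMap.range σ = LinearMap.ker p)
    (hσ : Function.Surjective (augPi μ k σ)) (v : Fin n → GR μ k) :
    ∃ c, sumGen μ k M (fun i => p (foxPi μ k n i (v - σ (const μ k n c)))) = p v := by
  obtain ⟨c, hc⟩ := hσ (aug μ k ∘ v)
  refine ⟨c, ?_⟩
  have hc' : aug μ k ∘ (v - σ (const μ k n c)) = 0 := by
    funext a
    have := congrFun hc a
    rw [Function.comp_apply, Pi.sub_apply, map_sub]
    exact sub_eq_zero.2 this.symm
  have hp : p (σ (const μ k n c)) = 0 := by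
    rw [← LinearMap.mem_ker, ← hσp]; exact ⟨_, rfl⟩
  simp only [sumGen_apply, ← map_smul, ← map_sum]
  rw [sum_foxPi_of_aug_eq_zero hc', map_sub, hp, sub_zero]

theorem sumGen_bijective (hp : Function.Surjective p) (hσp : LinearMap.range σ = LinearMap.ker p)
    (hσ : Function.Bijective (augPi μ k σ)) : Function.Bijective (sumGen μ k M) := by
  constructor
  · rw [injective_iff_map_eq_zero]
    intro m hm
    choose v hv using fun i => hp (m i)
    rw [sumGen_apply] at hm
    simp only [← hv, ← map_smul, ← map_sum] at hm
    rw [← LinearMap.mem_ker, ← hσp] at hm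
    obtain ⟨u, hu⟩ := hm
    have hu0 : aug μ k ∘ u = 0 := by
      apply hσ.1
      rw [← aug_map, hu, aug_sum_gen_smul]
      funext a
      have : σ (const μ k n 0) = 0 := by rw [map_zero, map_zero]
      exact ((congrArg (aug μ k) (congrFun this a)).trans (map_zero _)).symm
    funext i
    have h := congrArg (foxPi μ k n i) hu
    rw [← sum_foxPi_of_aug_eq_zero hu0] at h
    simp only [map_sum, map_smul, isFox_foxPi i, Finset.sum_ite_eq, Finset.mem_univ, if_true] at h
    rw [← hv, ← h, Pi.zero_apply, ← LinearMap.mem_ker, ← hσp]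
    exact ⟨_, rfl⟩
  · intro m
    obtain ⟨v, rfl⟩ := hp m
    obtain ⟨c, hc⟩ := exists_const_sumGen hσp hσ.2 v
    exact ⟨_, hc⟩

theorem exists_fox_lattice (hM : IsFlkField μ k M) :
    ∃ D : Fin μ → M →ₗ[k] M, IsFox D ∧ (∀ m, ∑ i, (gen k i - 1 : GR μ k) • D i m = m) ∧
      ∃ L, IsLattice D L := by
  obtain ⟨n, σ, p, -, hp, hσp, hσ⟩ := hM
  have hbij := sumGen_bijective hp hσp hσ
  let e := LinearEquiv.ofBijective (sumGen μ k M) hbij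
  have he : ∀ m, e.symm (sumGen μ k M m) = m := e.symm_apply_apply
  refine ⟨fun i => (LinearMap.proj i).comp e.symm.toLinearMap, ?_, ?_, ?_⟩
  · intro i j m
    have : (gen k j - 1 : GR μ k) • m = sumGen μ k M (Pi.single j m) := by
      rw [sumGen_apply, Finset.sum_eq_single j]
      · simp
      · intro b _ hb
        simp [hb]
      · simp
    change e.symm _ i = _
    rw [this, he, Pi.single_apply]
  · intro m
    have := e.apply_symm_apply m
    exact (sumGen_apply _).symm.trans this
  · obtain ⟨Q, h0, ⟨hfin, hQ⟩, hmem⟩ := exists_finite_inv Finset.univ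
      fun a : Fin n => σ (const μ k n (Pi.single a 1))
    have hσc : ∀ c, σ (const μ k n c) ∈ Q := by
      intro c
      have : c = ∑ a, c a • Pi.single a (1 : k) := by
        funext b
        simp [Finset.sum_apply, Pi.single_apply]
      have h2 : ∀ (d : k) w, σ (d • w) = d • σ w := (σ.restrictScalars k).map_smul
      rw [this, map_sum, map_sum]
      refine Q.sum_mem fun a ha => ?_
      rw [map_smul, h2]
      exact Q.smul_mem _ (hmem a ha)
    refine ⟨Q.map (p.restrictScalars k), inferInstance, ?_, ?_⟩
    · rintro i _ ⟨v, hv, rfl⟩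
      obtain ⟨c, hc⟩ := exists_const_sumGen hσp hσ.2 v
      have hD : e.symm (p v) i = p (foxPi μ k n i (v - σ (const μ k n c))) := by
        rw [← hc, he]
      obtain ⟨h1, h2⟩ := hQ i _ (Q.sub_mem hv (hσc c))
      change e.symm (p v) i ∈ _ ∧ _ • e.symm (p v) i ∈ _
      rw [hD, ← map_smul]
      exact ⟨⟨_, h1, rfl⟩, ⟨_, h2, rfl⟩⟩
    · have h1 : Submodule.span (GR μ k) (Q : Set (Fin n → GR μ k)) = ⊤ :=
        eq_top_iff.2 (span_const.symm.le.trans (Submodule.span_mono h0))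
      have h2 : ((Q.map (p.restrictScalars k) : Submodule k M) : Set M) = Set.image p Q := rfl
      rw [h2, ← Submodule.map_span, h1, Submodule.map_top, LinearMap.range_eq_top.2 hp]

theorem finite_end (hM : IsFlkField μ k M) : Module.Finite k (M →ₗ[GR μ k] M) := by
  obtain ⟨D, hD, hsum, hL⟩ := exists_fox_lattice hM
  obtain ⟨L, hL, hstab⟩ := exists_lattice_stable hD hsum hL
  have := hL.finite
  let res : (M →ₗ[GR μ k] M) →ₗ[k] (L →ₗ[k] L) :=
    { toFun := fun f => (f.restrictScalars k).restrict (hstab f)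
      map_add' := fun _ _ => rfl
      map_smul' := fun _ _ => rfl }
  refine Module.Finite.of_injective res fun f g hfg => ?_
  refine LinearMap.ext_on hL.span_eq_top fun l hl => ?_
  exact congrArg Subtype.val (LinearMap.congr_fun hfg ⟨l, hl⟩)

end Presentation

end FLink

/-- For `M ∈ Flk(k)`, the endomorphism ring `End_{k[F_μ]}(M)` is a
finite-dimensional `k`-vector space: there is a finite family of endomorphisms spanning it
over `k` (where `c ∈ k` acts on `M` through the central element `c·1 ∈ k[F_μ]`). -/
theorem statement10 (μ : ℕ) (k : Type*) [Field k]
    (M : Type*) [AddCommGroup M] [Module (GR μ k) M] (hM : IsFlkField μ k M) :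
    ∃ (n : ℕ) (g : Fin n → (M →ₗ[GR μ k] M)),
      ∀ f : M →ₗ[GR μ k] M, ∃ c : Fin n → k,
        ∀ m : M, f m = ∑ i, (MonoidAlgebra.single (1 : FG μ) (c i) : GR μ k) • (g i m) := by
  let : Module k M := Module.compHom M (algebraMap k (GR μ k))
  have : IsScalarTower k (GR μ k) M :=
    ⟨fun c r m => by rw [Algebra.smul_def, mul_smul]; rfl⟩
  have := FLink.finite_end hM
  let b := Module.finBasis k (M →ₗ[GR μ k] M)
  refine ⟨_, b, fun f => ⟨b.repr f, fun m => ?_⟩⟩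
  conv_lhs => rw [← b.sum_repr f]
  rw [LinearMap.sum_apply]
  rfl
end
end

section
/- Let A be an associative unital ring and let M, M′ be A[F_μ]-modules for which the maps γ_M : M^{⊕μ} → M and γ_{M′} : (M′)^{⊕μ} → M′ are bijective (for instance M, M′ ∈ Flk_∞(A)). An A-linear map f : M → M′ is A[F_μ]-linear if and only if it is a morphism of the induced Seifert modules U(M) → U(M′), that is, f∘(ω∘γ_M^{-1}) = (ω∘γ_{M′}^{-1})∘f and f∘(γ_M∘p_i∘γ_M^{-1}) = (γ_{M′}∘p_i∘γ_{M′}^{-1})∘f for every i = 1,…,μ. -/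
open Finsupp

noncomputable section

/-- Sato's map `γ : M^{⊕μ} → M`, `(m_1, …, m_μ) ↦ Σ_i (1 − z_i)·m_i`. -/
def gammaFun (μ : ℕ) (A : Type*) [Ring A] (M : Type*) [AddCommGroup M]
    [Module (GR μ A) M] : (Fin μ → M) → M :=
  fun m => ∑ i, (m i - (MonoidAlgebra.of A (FG μ) (FreeGroup.of i)) • m i)



section

variable {μ : ℕ} {A : Type*} [Ring A] {M M' : Type*} [AddCommGroup M] [Module (GR μ A) M]
  [AddCommGroup M'] [Module (GR μ A) M']

theorem gammaFun_single (i : Fin μ) (n : M) :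
    gammaFun μ A M (Pi.single i n) = n - MonoidAlgebra.of A (FG μ) (FreeGroup.of i) • n := by
  unfold gammaFun
  rw [Finset.sum_eq_single i]
  · simp only [Pi.single_eq_same]
  · intro j _ hj
    simp only [Pi.single_eq_of_ne hj, smul_zero, sub_zero]
  · simp

theorem map_gammaFun (f : M →+ M') (hf : ∀ (r : GR μ A) (m : M), f (r • m) = r • f m)
    (v : Fin μ → M) : f (gammaFun μ A M v) = gammaFun μ A M' (fun i => f (v i)) := by
  simp only [gammaFun, map_sum, map_sub, hf]

/-- An additive map commuting with the free generators commutes with the whole free group. -/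
theorem map_of_smul_of_generators (f : M →+ M')
    (hf : ∀ (i : Fin μ) (m : M), f (MonoidAlgebra.of A (FG μ) (FreeGroup.of i) • m)
      = MonoidAlgebra.of A (FG μ) (FreeGroup.of i) • f m) (g : FG μ) (m : M) :
    f (MonoidAlgebra.of A (FG μ) g • m) = MonoidAlgebra.of A (FG μ) g • f m := by
  induction g using FreeGroup.induction_on generalizing m with
  | C1 => simp only [map_one, one_smul]
  | of i => exact hf i m
  | inv_of i _ =>
    have hl : MonoidAlgebra.of A (FG μ) (FreeGroup.of i)⁻¹
        * MonoidAlgebra.of A (FG μ) (FreeGroup.of i) = 1 := by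
      rw [← map_mul, inv_mul_cancel, map_one]
    have hr : MonoidAlgebra.of A (FG μ) (FreeGroup.of i)
        * MonoidAlgebra.of A (FG μ) (FreeGroup.of i)⁻¹ = 1 := by
      rw [← map_mul, mul_inv_cancel, map_one]
    have h := hf i (MonoidAlgebra.of A (FG μ) (FreeGroup.of i)⁻¹ • m)
    rw [← mul_smul, hr, one_smul] at h
    rw [h, ← mul_smul, hl, one_smul]
  | mul x y hx hy => rw [map_mul, mul_smul, hx, hy, mul_smul]

/-- An additive map commuting with scalars and with the group elements is linear over the
group ring. -/
theorem map_smul_of_single_of (f : M →+ M')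
    (hA : ∀ (a : A) (m : M), f ((MonoidAlgebra.single (1 : FG μ) a : GR μ A) • m)
      = (MonoidAlgebra.single (1 : FG μ) a : GR μ A) • f m)
    (hG : ∀ (g : FG μ) (m : M), f (MonoidAlgebra.of A (FG μ) g • m)
      = MonoidAlgebra.of A (FG μ) g • f m) (r : GR μ A) (m : M) :
    f (r • m) = r • f m := by
  induction r using MonoidAlgebra.induction_linear with
  | zero => simp only [zero_smul, map_zero]
  | add x y hx hy => simp only [add_smul, map_add, hx, hy]
  | single g a =>
    have h : (MonoidAlgebra.single g a : GR μ A)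
        = MonoidAlgebra.single 1 a * MonoidAlgebra.of A (FG μ) g := by
      simp [MonoidAlgebra.of_apply, MonoidAlgebra.single_mul_single]
    rw [h, mul_smul, hA, hG, mul_smul]

theorem map_of_generator_smul (hγ : Function.Bijective (gammaFun μ A M))
    (hγ' : Function.Bijective (gammaFun μ A M')) (f : M →+ M')
    (hs : ∀ m : M, f (∑ i, Function.invFun (gammaFun μ A M) m i)
      = ∑ i, Function.invFun (gammaFun μ A M') (f m) i)
    (hπ : ∀ (i : Fin μ) (m : M),
      f (gammaFun μ A M (Pi.single i (Function.invFun (gammaFun μ A M) m i)))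
        = gammaFun μ A M' (Pi.single i (Function.invFun (gammaFun μ A M') (f m) i)))
    (i : Fin μ) (n : M) :
    f (MonoidAlgebra.of A (FG μ) (FreeGroup.of i) • n)
      = MonoidAlgebra.of A (FG μ) (FreeGroup.of i) • f n := by
  have hinv := Function.leftInverse_invFun hγ.injective
  have hinv' := Function.leftInverse_invFun hγ'.injective
  have hp := hπ i (gammaFun μ A M (Pi.single i n))
  have hn := hs (gammaFun μ A M (Pi.single i n))
  rw [hinv (Pi.single i n), Pi.single_eq_same] at hp
  rw [hinv (Pi.single i n), Finset.sum_pi_single', if_pos (Finset.mem_univ i)] at hn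
  generalize Function.invFun (gammaFun μ A M') (f (gammaFun μ A M (Pi.single i n))) i = k at hp
  rw [hp, hinv' (Pi.single i k), Finset.sum_pi_single', if_pos (Finset.mem_univ i)] at hn
  rw [← hn, gammaFun_single, gammaFun_single, map_sub] at hp
  exact sub_right_injective hp

end

/-- Let `M, M'` be `A[F_μ]`-modules for which the maps `γ_M, γ_{M'}` are
bijective.  An `A`-linear map `f : M → M'` is `A[F_μ]`-linear if and only if it is a
morphism of the induced Seifert modules `U(M) → U(M')`, i.e. it commutes with
`ω ∘ γ⁻¹` and with each `γ ∘ p_i ∘ γ⁻¹`. -/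
theorem statement15 (μ : ℕ) (A : Type*) [Ring A]
    (M M' : Type*) [AddCommGroup M] [Module (GR μ A) M]
    [AddCommGroup M'] [Module (GR μ A) M']
    [Module A M]
    (hAM : ∀ (a : A) (m : M), a • m = (MonoidAlgebra.single (1 : FG μ) a : GR μ A) • m)
    [Module A M']
    (hAM' : ∀ (a : A) (m : M'), a • m = (MonoidAlgebra.single (1 : FG μ) a : GR μ A) • m)
    (hγ : Function.Bijective (gammaFun μ A M))
    (hγ' : Function.Bijective (gammaFun μ A M'))
    (f : M →ₗ[A] M') :
    (∀ (r : GR μ A) (m : M), f (r • m) = r • f m) ↔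
      ((∀ m : M, f (∑ i, Function.invFun (gammaFun μ A M) m i)
          = ∑ i, Function.invFun (gammaFun μ A M') (f m) i) ∧
       (∀ (i : Fin μ) (m : M),
          f (gammaFun μ A M (Pi.single i (Function.invFun (gammaFun μ A M) m i)))
            = gammaFun μ A M' (Pi.single i (Function.invFun (gammaFun μ A M') (f m) i)))) := by
  have hinv := Function.leftInverse_invFun hγ.injective
  have hinv' := Function.leftInverse_invFun hγ'.injective
  constructor
  · intro hf
    have hcomm (v : Fin μ → M) : Function.invFun (gammaFun μ A M') (f (gammaFun μ A M v))
        = fun i => f (v i) := by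
      rw [← hinv' fun i => f (v i)]
      exact congrArg _ (map_gammaFun f.toAddMonoidHom hf v)
    refine ⟨fun m => ?_, fun i m => ?_⟩
    · obtain ⟨v, rfl⟩ := hγ.surjective m
      rw [hcomm, hinv v, map_sum]
    · obtain ⟨v, rfl⟩ := hγ.surjective m
      rw [hcomm, hinv v, gammaFun_single, gammaFun_single, map_sub, hf]
  · rintro ⟨hs, hπ⟩
    refine map_smul_of_single_of f.toAddMonoidHom (fun a m => ?_)
      (map_of_smul_of_generators f.toAddMonoidHom
        (map_of_generator_smul hγ hγ' f.toAddMonoidHom hs hπ))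
    rw [← hAM, ← hAM']
    exact f.map_smul a m
end
end
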